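/- arXiv:2502.04477 — 5 statements merged into one kernel-verified Lean document; each statement's English description precedes it below -/
import Mathlib

section
/- (Bellman residual bounds the policy optimality gap, Proposition 2.1.) Let Q ∈ ℝ^{𝒮×𝒜} and let π : 𝒮 → 𝒜 be a greedy policy for Q, i.e. Q(s,π(s)) = max_{a∈𝒜} Q(s,a) for all s. Let π' : 𝒮 → 𝒜 be any policy. For a policy σ write P_σ for the S×S matrix P_σ(s'|s) = 𝒫(s'|s,σ(s)) and r_σ(s) = r(s,σ(s)), and suppose the Cesàro limits g_π(s) = lim_{n→∞} (1/n)·∑_{t=0}^{n−1} (P_π^t r_π)(s) and g_{π'}(s) = lim_{n→∞} (1/n)·∑_{t=0}^{n−1} (P_{π'}^t r_{π'})(s) exist for all s ∈ 𝒮. Then for all s ∈ 𝒮, g_π(s) ≥ min_{(s'',a'')∈𝒮×𝒜} (𝒯(Q) − Q)(s'',a'') and g_{π'}(s) ≤ max_{(s'',a'')∈𝒮×𝒜} (𝒯(Q) − Q)(s'',a''); in particular g_{π'}(s') − g_π(s) ≤ sp(𝒯(Q) − Q) for all s, s' ∈ 𝒮. -/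
open Finset

/-- Span seminorm: `sp x = max x − min x` on a nonempty finite index set. -/
noncomputable def sp {J : Type*} [Fintype J] [Nonempty J] (x : J → ℝ) : ℝ :=
  (univ.sup' univ_nonempty x) - (univ.inf' univ_nonempty x)

/-- Sup norm `‖x‖_∞ = max_j |x j|` on a nonempty finite index set. -/
noncomputable def supNorm {J : Type*} [Fintype J] [Nonempty J] (x : J → ℝ) : ℝ :=
  univ.sup' univ_nonempty (fun j => |x j|)

/-- `P` is a transition kernel: nonnegative entries, each row sums to one. -/
def IsKernel {S A : Type*} [Fintype S] (P : S → A → S → ℝ) : Prop :=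
  (∀ s a s', 0 ≤ P s a s') ∧ (∀ s a, ∑ s', P s a s' = 1)

/-- The Bellman operator `𝒯(Q)(s,a) = r(s,a) + ∑_{s'} P(s'|s,a)·max_{a'} Q(s',a')`. -/
noncomputable def bellman {S A : Type*} [Fintype S] [Fintype A] [Nonempty A]
    (P : S → A → S → ℝ) (r : S → A → ℝ) (Q : S × A → ℝ) : S × A → ℝ :=
  fun p => r p.1 p.2 + ∑ s', P p.1 p.2 s' * (univ.sup' univ_nonempty (fun a' => Q (s', a')))

/-- The anchoring coefficients `β_k = k/(k+2)`. -/
noncomputable def beta (k : ℕ) : ℝ := (k : ℝ) / ((k : ℝ) + 2)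

/-- The transition matrix `P_σ(s'|s) = 𝒫(s'|s,σ(s))` of the Markov chain induced by a
stationary deterministic policy `σ`. -/
def policyMatrix {S A : Type*} (P : S → A → S → ℝ) (σ : S → A) : Matrix S S ℝ :=
  fun s s' => P s (σ s) s'

/-- The reward vector `r_σ(s) = r(s,σ(s))` of a policy `σ`. -/
def policyReward {S A : Type*} (r : S → A → ℝ) (σ : S → A) : S → ℝ :=
  fun s => r s (σ s)

theorem le_mulVec_of_mem_rowStochastic {S : Type*} [Fintype S] [DecidableEq S]
    {M : Matrix S S ℝ} (hM : M ∈ Matrix.rowStochastic ℝ S) {x : S → ℝ} {c : ℝ}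
    (hx : ∀ s, c ≤ x s) (s : S) : c ≤ M.mulVec x s := by
  rw [Matrix.mem_rowStochastic_iff_sum] at hM
  calc c = ∑ j, M s j * c := by rw [← Finset.sum_mul, hM.2 s, one_mul]
    _ ≤ ∑ j, M s j * x j :=
      Finset.sum_le_sum fun j _ => mul_le_mul_of_nonneg_left (hx j) (hM.1 s j)

/-- A lower bound on `r + M h - h` is a lower bound on the Cesàro limit of `M ^ t r`. -/
theorem le_cesaro_limit_of_le_residual {S : Type*} [Fintype S] [DecidableEq S]
    {M : Matrix S S ℝ} (hM : M ∈ Matrix.rowStochastic ℝ S) {r h : S → ℝ} {c : ℝ}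
    (hc : ∀ s, c ≤ (r + M.mulVec h - h) s) {s : S} {g : ℝ}
    (hg : Filter.Tendsto
      (fun n : ℕ => (1 / (n : ℝ)) * ∑ t ∈ Finset.range n, ((M ^ t).mulVec r) s)
      Filter.atTop (nhds g)) : c ≤ g := by
  have telescope : ∀ n : ℕ, (n : ℝ) * c ≤
      ∑ t ∈ Finset.range n, ((M ^ t).mulVec r) s + (M ^ n).mulVec h s - h s := by
    intro n
    induction n with
    | zero => simp
    | succ n ih =>
      have step := le_mulVec_of_mem_rowStochastic (pow_mem hM n) hc s
      rw [Matrix.mulVec_sub, Matrix.mulVec_add, Matrix.mulVec_mulVec, ← pow_succ] at step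
      simp only [Pi.sub_apply, Pi.add_apply] at step
      rw [Finset.sum_range_succ]
      push_cast
      linarith
  obtain ⟨B, hB⟩ := (Set.finite_range h).bddAbove
  have bound : ∀ n : ℕ, (M ^ n).mulVec h s ≤ B := by
    intro n
    have := le_mulVec_of_mem_rowStochastic (pow_mem hM n) (x := -h) (c := -B)
      (fun s => neg_le_neg (hB ⟨s, rfl⟩)) s
    rw [Matrix.mulVec_neg] at this
    exact neg_le_neg_iff.mp this
  have lim := hg.add (tendsto_const_div_atTop_nhds_zero_nat (B - h s))
  rw [add_zero] at lim
  refine ge_of_tendsto lim ?_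
  filter_upwards [Filter.eventually_gt_atTop 0] with n hn
  have hn' : (0 : ℝ) < n := Nat.cast_pos.mpr hn
  rw [one_div_mul_eq_div, ← add_div, le_div_iff₀ hn']
  linarith [telescope n, bound n]

/-- An upper bound on `r + M h - h` is an upper bound on the Cesàro limit of `M ^ t r`. -/
theorem cesaro_limit_le_of_residual_le {S : Type*} [Fintype S] [DecidableEq S]
    {M : Matrix S S ℝ} (hM : M ∈ Matrix.rowStochastic ℝ S) {r h : S → ℝ} {c : ℝ}
    (hc : ∀ s, (r + M.mulVec h - h) s ≤ c) {s : S} {g : ℝ}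
    (hg : Filter.Tendsto
      (fun n : ℕ => (1 / (n : ℝ)) * ∑ t ∈ Finset.range n, ((M ^ t).mulVec r) s)
      Filter.atTop (nhds g)) : g ≤ c := by
  refine neg_le_neg_iff.mp
    (le_cesaro_limit_of_le_residual hM (r := -r) (h := -h) (fun s => ?_) (s := s) ?_)
  · have := hc s
    simp only [Matrix.mulVec_neg, Pi.sub_apply, Pi.add_apply, Pi.neg_apply] at this ⊢
    linarith
  · simpa only [Matrix.mulVec_neg, Pi.neg_apply, Finset.sum_neg_distrib, mul_neg] using hg.neg

theorem policyMatrix_mem_rowStochastic {S A : Type*} [Fintype S] [DecidableEq S]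
    {P : S → A → S → ℝ} (hP : IsKernel P) (σ : S → A) :
    policyMatrix P σ ∈ Matrix.rowStochastic ℝ S :=
  Matrix.mem_rowStochastic_iff_sum.mpr ⟨fun s => hP.1 s (σ s), fun s => hP.2 s (σ s)⟩

/-- The residual of the state values `max_a Q(s,a)` under `σ`, via the Bellman operator. -/
theorem policy_residual_eq {S A : Type*} [Fintype S] [Fintype A] [Nonempty A]
    (P : S → A → S → ℝ) (r : S → A → ℝ) (Q : S × A → ℝ) (σ : S → A) (s : S) :
    (policyReward r σ + (policyMatrix P σ).mulVec
        (fun s => univ.sup' univ_nonempty (fun a => Q (s, a))) -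
        fun s => univ.sup' univ_nonempty (fun a => Q (s, a))) s =
      bellman P r Q (s, σ s) - univ.sup' univ_nonempty (fun a => Q (s, a)) :=
  rfl

/-- Proposition 2.1: if `π` is greedy for `Q` and the Cesàro-average gains of `π` and of
any policy `π'` exist, then `g_π ≥ min (𝒯Q − Q)`, `g_{π'} ≤ max (𝒯Q − Q)`, and hence
`g_{π'}(s') − g_π(s) ≤ sp(𝒯Q − Q)`. -/
theorem gain_gap_le_span_residual
    {S A : Type*} [Fintype S] [Nonempty S] [DecidableEq S] [Fintype A] [Nonempty A]
    (P : S → A → S → ℝ) (hP : IsKernel P) (r : S → A → ℝ)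
    (Q : S × A → ℝ) (π π' : S → A)
    (hgreedy : ∀ s, Q (s, π s) = univ.sup' univ_nonempty (fun a => Q (s, a)))
    (gπ gπ' : S → ℝ)
    (hgπ : ∀ s, Filter.Tendsto
      (fun n : ℕ => (1 / (n : ℝ)) *
        ∑ t ∈ Finset.range n, ((policyMatrix P π ^ t).mulVec (policyReward r π)) s)
      Filter.atTop (nhds (gπ s)))
    (hgπ' : ∀ s, Filter.Tendsto
      (fun n : ℕ => (1 / (n : ℝ)) *
        ∑ t ∈ Finset.range n, ((policyMatrix P π' ^ t).mulVec (policyReward r π')) s)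
      Filter.atTop (nhds (gπ' s))) :
    (∀ s, univ.inf' univ_nonempty (fun p : S × A => bellman P r Q p - Q p) ≤ gπ s) ∧
    (∀ s, gπ' s ≤ univ.sup' univ_nonempty (fun p : S × A => bellman P r Q p - Q p)) ∧
    (∀ s s', gπ' s' - gπ s ≤ sp (fun p : S × A => bellman P r Q p - Q p)) := by
  have lower : ∀ s, univ.inf' univ_nonempty (fun p : S × A => bellman P r Q p - Q p) ≤ gπ s :=
    fun s => le_cesaro_limit_of_le_residual (policyMatrix_mem_rowStochastic hP π)
      (fun s => by
        rw [policy_residual_eq, ← hgreedy s]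
        exact inf'_le (fun p : S × A => bellman P r Q p - Q p) (mem_univ (s, π s))) (hgπ s)
  have upper : ∀ s, gπ' s ≤ univ.sup' univ_nonempty (fun p : S × A => bellman P r Q p - Q p) :=
    fun s => cesaro_limit_le_of_residual_le (policyMatrix_mem_rowStochastic hP π')
      (fun s => by
        rw [policy_residual_eq]
        exact (sub_le_sub_left (le_sup' (fun a => Q (s, a)) (mem_univ (π' s))) _).trans
          (le_sup' (fun p : S × A => bellman P r Q p - Q p) (mem_univ (s, π' s)))) (hgπ' s)
  exact ⟨lower, upper, fun s s' => sub_le_sub (upper s') (lower s)⟩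
end

section
/- (Lemma A.1.) Under hypotheses (i)–(iii) of the inexact anchored iteration, for all 0 ≤ k ≤ n one has sp(Q^k − Q^*) ≤ sp(Q^0 − Q^*) + (2/3)·ε·k. -/
open Finset

theorem sub_le_sp {J : Type*} [Fintype J] [Nonempty J] (x : J → ℝ) (i j : J) :
    x i - x j ≤ sp x :=
  sub_le_sub (le_sup' x (mem_univ i)) (inf'_le x (mem_univ j))

theorem sp_le {J : Type*} [Fintype J] [Nonempty J] {x : J → ℝ} {c : ℝ}
    (h : ∀ i j, x i - x j ≤ c) : sp x ≤ c := by
  obtain ⟨i, -, hi⟩ := exists_mem_eq_sup' univ_nonempty x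
  obtain ⟨j, -, hj⟩ := exists_mem_eq_inf' univ_nonempty x
  rw [sp, hi, hj]
  exact h i j

theorem abs_le_supNorm {J : Type*} [Fintype J] [Nonempty J] (x : J → ℝ) (j : J) :
    |x j| ≤ supNorm x :=
  le_sup' (fun j => |x j|) (mem_univ j)

theorem bellman_le_bellman_add {S A : Type*} [Fintype S] [Fintype A] [Nonempty A]
    {P : S → A → S → ℝ} (hP : IsKernel P) (r : S → A → ℝ) {Q Q' : S × A → ℝ} {c : ℝ}
    (h : ∀ p, Q p ≤ Q' p + c) (p : S × A) : bellman P r Q p ≤ bellman P r Q' p + c := by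
  have hsup (s : S) : univ.sup' univ_nonempty (fun a => Q (s, a)) ≤
      univ.sup' univ_nonempty (fun a => Q' (s, a)) + c :=
    sup'_le _ _ fun a _ => (h (s, a)).trans <|
      add_le_add_left (le_sup' (fun a => Q' (s, a)) (mem_univ a)) c
  have hsum := sum_le_sum fun s (_ : s ∈ univ) =>
    mul_le_mul_of_nonneg_left (hsup s) (hP.1 p.1 p.2 s)
  simp only [mul_add, sum_add_distrib, ← sum_mul, hP.2, one_mul] at hsum
  simp only [bellman]
  linarith

/-- The Bellman operator is nonexpansive in the span seminorm. -/
theorem sp_bellman_sub_le {S A : Type*} [Fintype S] [Nonempty S] [Fintype A] [Nonempty A]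
    {P : S → A → S → ℝ} (hP : IsKernel P) (r : S → A → ℝ) (Q Q' : S × A → ℝ) :
    sp (fun p => bellman P r Q p - bellman P r Q' p) ≤ sp (fun p => Q p - Q' p) := by
  refine sp_le fun p q => ?_
  have hmax := bellman_le_bellman_add hP r (Q := Q) (Q' := Q')
    (c := univ.sup' univ_nonempty fun p => Q p - Q' p)
    (fun i => by linarith [le_sup' (fun p => Q p - Q' p) (mem_univ i)]) p
  have hmin := bellman_le_bellman_add hP r (Q := Q') (Q' := Q)
    (c := -univ.inf' univ_nonempty fun p => Q p - Q' p)
    (fun i => by linarith [inf'_le (fun p => Q p - Q' p) (mem_univ i)]) q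
  rw [sp]
  linarith

/-- An `ε`-approximate Bellman update increases the span distance to a fixed point (up to
constants) by at most `2ε`. -/
theorem sp_sub_le_of_supNorm_sub_bellman_le {S A : Type*} [Fintype S] [Nonempty S]
    [Fintype A] [Nonempty A] {P : S → A → S → ℝ} (hP : IsKernel P) {r : S → A → ℝ}
    {Q T Qstar : S × A → ℝ} {ε g : ℝ}
    (hT : supNorm (fun p => T p - bellman P r Q p) ≤ ε)
    (hstar : bellman P r Qstar = fun p => Qstar p + g) :
    sp (fun p => T p - Qstar p) ≤ sp (fun p => Q p - Qstar p) + 2 * ε := by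
  refine sp_le fun p q => ?_
  have hp := abs_le.1 ((abs_le_supNorm _ p).trans hT)
  have hq := abs_le.1 ((abs_le_supNorm _ q).trans hT)
  have hpq := (sub_le_sp _ p q).trans (sp_bellman_sub_le hP r Q Qstar)
  simp only [hstar] at hpq
  linarith [hp.2, hq.1]

/-- The span seminorm is convex. -/
theorem sp_convexCombo_sub_le {J : Type*} [Fintype J] [Nonempty J] (x y z : J → ℝ) {b : ℝ}
    (hb0 : 0 ≤ b) (hb1 : b ≤ 1) :
    sp (fun p => (1 - b) * x p + b * y p - z p) ≤
      (1 - b) * sp (fun p => x p - z p) + b * sp (fun p => y p - z p) := by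
  refine sp_le fun i j => ?_
  have hx := mul_le_mul_of_nonneg_left (sub_le_sp (fun p => x p - z p) i j) (sub_nonneg.2 hb1)
  have hy := mul_le_mul_of_nonneg_left (sub_le_sp (fun p => y p - z p) i j) hb0
  linarith

theorem beta_nonneg (k : ℕ) : 0 ≤ beta k := by
  unfold beta
  positivity

theorem beta_le_one (k : ℕ) : beta k ≤ 1 :=
  div_le_one_of_le₀ (by linarith) (by positivity)

/-- Lemma A.1: under the inexact anchored iteration hypotheses (i)–(iii),
`sp(Q^k − Q^*) ≤ sp(Q^0 − Q^*) + (2/3)·ε·k` for all `0 ≤ k ≤ n`. -/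
theorem savia_lemma_A1

    {S A : Type*} [Fintype S] [Nonempty S] [Fintype A] [Nonempty A]
    (P : S → A → S → ℝ) (hP : IsKernel P) (r : S → A → ℝ)
    (ε : ℝ) (hε : 0 ≤ ε) (n : ℕ)
    (Q T : ℕ → S × A → ℝ) (Qstar : S × A → ℝ) (gstar : ℝ)
    (h1 : ∀ k, 1 ≤ k → k ≤ n →
      Q k = fun p => (1 - beta k) * Q 0 p + beta k * T (k - 1) p)
    (h2 : ∀ k, k ≤ n → supNorm (fun p => T k p - bellman P r (Q k) p) ≤ ε)
    (h3 : bellman P r Qstar = fun p => Qstar p + gstar)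
    :
    ∀ k, k ≤ n → sp (fun p => Q k p - Qstar p)
      ≤ sp (fun p => Q 0 p - Qstar p) + (2 / 3) * ε * (k : ℝ) := by
  intro k
  induction k with
  | zero => simp
  | succ k ih =>
    intro hk
    have hT := sp_sub_le_of_supNorm_sub_bellman_le hP (h2 k (by omega)) h3
    have hQ := sp_convexCombo_sub_le (Q 0) (T k) Qstar (beta_nonneg (k + 1)) (beta_le_one (k + 1))
    have hstep := mul_le_mul_of_nonneg_left
      (hT.trans (add_le_add_left (ih (by omega)) (2 * ε))) (beta_nonneg (k + 1))
    have hbeta : beta (k + 1) * ((k : ℝ) + 3) = k + 1 := by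
      unfold beta
      push_cast
      field_simp
      ring
    rw [h1 (k + 1) (by omega) hk, Nat.add_sub_cancel]
    push_cast
    linear_combination hQ + hstep + 2 / 3 * ε * hbeta
end

section
/- (Uniform span bounds, deterministic part of Lemma A.4.) Let β_k = k/(k+2) and let T^{−1}, T^0, …, T^n and Q^0, …, Q^n in ℝ^{𝒮×𝒜} satisfy T^{−1} = r and Q^k = (1 − β_k)·Q^0 + β_k·T^{k−1} for 0 ≤ k ≤ n. Define h^{−1} = 0 ∈ ℝ^𝒮, h^k(s) = max_{a∈𝒜} Q^k(s,a) for 0 ≤ k ≤ n, and d^k = h^k − h^{k−1}. Assume sp(T^k − T^{k−1}) ≤ sp(d^k) for all 0 ≤ k ≤ n. Then, with κ = max{sp(r), sp(Q^0)}, for all 0 ≤ k ≤ n one has sp(d^k) ≤ κ and sp(T^{k−1}) ≤ (k+1)·κ. -/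
open Finset

theorem sp_le_iff {J : Type*} [Fintype J] [Nonempty J] {x : J → ℝ} {c : ℝ} :
    sp x ≤ c ↔ ∀ i j, x i - x j ≤ c := by
  unfold sp
  constructor
  · intro hx i j
    have hi := le_sup' x (mem_univ i)
    have hj := inf'_le x (mem_univ j)
    linarith
  · intro hx
    obtain ⟨i, -, hi⟩ := exists_mem_eq_sup' univ_nonempty x
    obtain ⟨j, -, hj⟩ := exists_mem_eq_inf' univ_nonempty x
    rw [hi, hj]
    exact hx i j

/-- Maximising over the second argument is nonexpansive for the span seminorm. -/
theorem sp_sup'_sub_sup'_le {S A : Type*} [Fintype S] [Nonempty S] [Fintype A] [Nonempty A]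
    (f g : S × A → ℝ) :
    sp (fun s => univ.sup' univ_nonempty (fun a => f (s, a)) -
      univ.sup' univ_nonempty (fun a => g (s, a))) ≤ sp (fun p => f p - g p) := by
  refine sp_le_iff.2 fun s t => ?_
  obtain ⟨a, -, ha⟩ := exists_mem_eq_sup' univ_nonempty (fun a => f (s, a))
  obtain ⟨b, -, hb⟩ := exists_mem_eq_sup' univ_nonempty (fun a => g (t, a))
  have h₁ := le_sup' (fun a => g (s, a)) (mem_univ a)
  have h₂ := le_sup' (fun a => f (t, a)) (mem_univ b)
  have h₃ := sub_le_sp (fun p => f p - g p) (s, a) (t, b)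
  linarith

theorem sp_sup'_le {S A : Type*} [Fintype S] [Nonempty S] [Fintype A] [Nonempty A]
    (f : S × A → ℝ) :
    sp (fun s => univ.sup' univ_nonempty (fun a => f (s, a))) ≤ sp f := by
  simpa using sp_sup'_sub_sup'_le f (fun _ => 0)

/-- The increment of an anchored average, bounded in the span seminorm. -/
theorem sp_anchored_sub_le {J : Type*} [Fintype J] [Nonempty J] (x y z : J → ℝ) {κ : ℝ} (k : ℕ)
    (hx : sp x ≤ κ) (hy : sp y ≤ ((k : ℝ) + 1) * κ) (hz : sp (fun p => z p - y p) ≤ κ) :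
    sp (fun p => ((1 - beta (k + 1)) * x p + beta (k + 1) * z p) -
      ((1 - beta k) * x p + beta k * y p)) ≤ κ := by
  refine sp_le_iff.2 fun i j => ?_
  have h₁ := sp_le_iff.1 hx j i
  have h₂ := sp_le_iff.1 hy i j
  have h₃ := sp_le_iff.1 hz i j
  have hβ : beta (k + 1) = ((k : ℝ) + 1) / (k + 3) := by
    unfold beta
    push_cast
    ring
  have hΔ : beta (k + 1) - beta k = 2 / (((k : ℝ) + 2) * (k + 3)) := by
    rw [hβ, beta]
    field_simp
    ring
  have hsum : (beta (k + 1) - beta k) * ((k : ℝ) + 2) + beta (k + 1) = 1 := by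
    rw [hΔ, hβ]
    field_simp
    ring
  have hβ_nonneg : 0 ≤ beta (k + 1) := by
    rw [hβ]
    positivity
  have hΔ_nonneg : 0 ≤ beta (k + 1) - beta k := by
    rw [hΔ]
    positivity
  have h₄ : (y i - y j) + (x j - x i) ≤ ((k : ℝ) + 2) * κ := by linarith
  have h₅ := mul_le_mul_of_nonneg_left h₄ hΔ_nonneg
  have h₆ := mul_le_mul_of_nonneg_left h₃ hβ_nonneg
  linear_combination h₅ + h₆ + κ * hsum

theorem sp_le_sp_add_sp_sub {J : Type*} [Fintype J] [Nonempty J] (x y : J → ℝ) :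
    sp x ≤ sp y + sp (fun p => x p - y p) := by
  refine sp_le_iff.2 fun i j => ?_
  have h₁ := sub_le_sp y i j
  have h₂ := sub_le_sp (fun p => x p - y p) i j
  linarith

/-- Uniform span bounds (deterministic part of Lemma A.4).
Here the index of `T` and `h` is shifted by one: `T k` stands for `T^{k−1}` (so `T 0 = r`)
and `h k` stands for `h^{k−1}` (so `h 0 = 0` and `h (k+1) = max_𝒜 Q^k`); `d k` stands for
`d^k = h^k − h^{k−1}`.  Under the anchored recursion and the sampling contraction
`sp(T^k − T^{k−1}) ≤ sp(d^k)`, one has `sp(d^k) ≤ κ` and `sp(T^{k−1}) ≤ (k+1)·κ`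
for all `0 ≤ k ≤ n`, where `κ = max{sp r, sp Q^0}`. -/
theorem savia_uniform_span_bounds
    {S A : Type*} [Fintype S] [Nonempty S] [Fintype A] [Nonempty A]
    (r : S → A → ℝ) (n : ℕ)
    (Q T : ℕ → S × A → ℝ) (h : ℕ → S → ℝ)
    (hT0 : T 0 = fun p => r p.1 p.2)
    (hrec : ∀ k, k ≤ n → Q k = fun p => (1 - beta k) * Q 0 p + beta k * T k p)
    (hh0 : h 0 = fun _ => (0 : ℝ))
    (hh : ∀ k, k ≤ n → h (k + 1) = fun s => univ.sup' univ_nonempty (fun a => Q k (s, a)))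
    (hcontr : ∀ k, k ≤ n →
      sp (fun p => T (k + 1) p - T k p) ≤ sp (fun s => h (k + 1) s - h k s)) :
    ∀ k, k ≤ n →
      sp (fun s => h (k + 1) s - h k s)
          ≤ max (sp (fun p : S × A => r p.1 p.2)) (sp (Q 0)) ∧
      sp (T k) ≤ ((k : ℝ) + 1) * max (sp (fun p : S × A => r p.1 p.2)) (sp (Q 0)) := by
  intro k
  set κ := max (sp (fun p : S × A => r p.1 p.2)) (sp (Q 0))
  have hQ0 : sp (Q 0) ≤ κ := le_max_right _ _
  induction k with
  | zero =>
    intro hk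
    constructor
    · simpa only [hh 0 hk, hh0, sub_zero] using (sp_sup'_le (Q 0)).trans hQ0
    · rw [hT0]
      have hr : sp (fun p : S × A => r p.1 p.2) ≤ κ := le_max_left _ _
      simpa only [Nat.cast_zero, zero_add, one_mul] using hr
  | succ k ih =>
    intro hk
    have hk' : k ≤ n := Nat.le_of_succ_le hk
    obtain ⟨hd, hT⟩ := ih hk'
    have hinc := (hcontr k hk').trans hd
    constructor
    · rw [hh (k + 1) hk, hh k hk']
      refine (sp_sup'_sub_sup'_le (Q (k + 1)) (Q k)).trans ?_
      rw [hrec (k + 1) hk, hrec k hk']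
      exact sp_anchored_sub_le (Q 0) (T k) (T (k + 1)) k hQ0 hT hinc
    · have := sp_le_sp_add_sp_sub (T (k + 1)) (T k)
      push_cast
      linarith
end

section
/- (Lemma B.1, discounted case.) Under hypotheses (i)–(iii) of the discounted inexact anchored iteration, for all 0 ≤ k ≤ n one has ‖Q^k − Q^*‖_∞ ≤ ‖Q^0 − Q^*‖_∞ + (1/3)·ε·k. -/
open Finset

/-- The discounted Bellman operator
`𝒯_γ(Q)(s,a) = r(s,a) + γ·∑_{s'} P(s'|s,a)·max_{a'} Q(s',a')`. -/
noncomputable def bellmanD {S A : Type*} [Fintype S] [Fintype A] [Nonempty A]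
    (γ : ℝ) (P : S → A → S → ℝ) (r : S → A → ℝ) (Q : S × A → ℝ) : S × A → ℝ :=
  fun p => r p.1 p.2 +
    γ * ∑ s', P p.1 p.2 s' * (univ.sup' univ_nonempty (fun a' => Q (s', a')))

theorem supNorm_le_iff {J : Type*} [Fintype J] [Nonempty J] {x : J → ℝ} {c : ℝ} :
    supNorm x ≤ c ↔ ∀ j, |x j| ≤ c := by
  simp [supNorm]

theorem supNorm_nonneg {J : Type*} [Fintype J] [Nonempty J] (x : J → ℝ) : 0 ≤ supNorm x :=
  (abs_nonneg _).trans (abs_le_supNorm x (Classical.arbitrary J))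

theorem abs_sup'_sub_sup'_le {J : Type*} [Fintype J] [Nonempty J] {f g : J → ℝ} {c : ℝ}
    (h : ∀ j, |f j - g j| ≤ c) :
    |univ.sup' univ_nonempty f - univ.sup' univ_nonempty g| ≤ c := by
  have hf : univ.sup' univ_nonempty f ≤ univ.sup' univ_nonempty g + c :=
    sup'_le _ _ fun j _ => by
      linarith [(abs_le.1 (h j)).2, le_sup' g (mem_univ j)]
  have hg : univ.sup' univ_nonempty g ≤ univ.sup' univ_nonempty f + c :=
    sup'_le _ _ fun j _ => by
      linarith [(abs_le.1 (h j)).1, le_sup' f (mem_univ j)]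
  exact abs_le.2 ⟨by linarith, by linarith⟩

theorem IsKernel.abs_sum_mul_le {S A : Type*} [Fintype S] {P : S → A → S → ℝ}
    (hP : IsKernel P) (s : S) (a : A) {v : S → ℝ} {c : ℝ} (h : ∀ s', |v s'| ≤ c) :
    |∑ s', P s a s' * v s'| ≤ c :=
  calc |∑ s', P s a s' * v s'| ≤ ∑ s', |P s a s' * v s'| := abs_sum_le_sum_abs _ _
    _ ≤ ∑ s', P s a s' * c := sum_le_sum fun s' _ => by
      rw [abs_mul, abs_of_nonneg (hP.1 s a s')]
      exact mul_le_mul_of_nonneg_left (h s') (hP.1 s a s')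
    _ = c := by rw [← sum_mul, hP.2, one_mul]

theorem abs_bellmanD_sub_le {S A : Type*} [Fintype S] [Nonempty S] [Fintype A] [Nonempty A]
    {γ : ℝ} (hγ : 0 ≤ γ) {P : S → A → S → ℝ} (hP : IsKernel P) (r : S → A → ℝ)
    (Q R : S × A → ℝ) (p : S × A) :
    |bellmanD γ P r Q p - bellmanD γ P r R p| ≤ γ * supNorm (fun p => Q p - R p) := by
  have h := hP.abs_sum_mul_le p.1 p.2 fun s' =>
    abs_sup'_sub_sup'_le fun a' => abs_le_supNorm (fun p => Q p - R p) (s', a')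
  simp only [mul_sub, sum_sub_distrib] at h
  simp only [bellmanD]
  rw [add_sub_add_left_eq_sub, ← mul_sub, abs_mul, abs_of_nonneg hγ]
  exact mul_le_mul_of_nonneg_left h hγ

/-- Lemma B.1 (discounted case): under hypotheses (i)–(iii) of the discounted inexact
anchored iteration, `‖Q^k − Q^*‖_∞ ≤ ‖Q^0 − Q^*‖_∞ + (1/3)·ε·k` for all `0 ≤ k ≤ n`. -/
theorem savid_lemma_B1

    {S A : Type*} [Fintype S] [Nonempty S] [Fintype A] [Nonempty A]
    (γ : ℝ) (hγ0 : 0 < γ) (hγ1 : γ < 1)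
    (P : S → A → S → ℝ) (hP : IsKernel P) (r : S → A → ℝ)
    (ε : ℝ) (hε : 0 ≤ ε) (n : ℕ)
    (Q T : ℕ → S × A → ℝ) (Qstar : S × A → ℝ)
    (h1 : ∀ k, 1 ≤ k → k ≤ n →
      Q k = fun p => (1 - beta k) * Q 0 p + beta k * T (k - 1) p)
    (h2 : ∀ k, k ≤ n → supNorm (fun p => T k p - bellmanD γ P r (Q k) p) ≤ ε)
    (h3 : Qstar = bellmanD γ P r Qstar)
    :
    ∀ k, k ≤ n → supNorm (fun p => Q k p - Qstar p)
      ≤ supNorm (fun p => Q 0 p - Qstar p) + (1 / 3) * ε * (k : ℝ) := by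
  intro k
  induction k with
  | zero => simp
  | succ k ih =>
    intro hk
    have ih := ih (by omega)
    refine supNorm_le_iff.2 fun p => ?_
    have hT := supNorm_le_iff.1 (h2 k (by omega)) p
    have hB := abs_bellmanD_sub_le hγ0.le hP r (Q k) Qstar p
    rw [← h3] at hB
    have hγk : γ * supNorm (fun p => Q k p - Qstar p) ≤ supNorm (fun p => Q k p - Qstar p) :=
      mul_le_of_le_one_left (supNorm_nonneg _) hγ1.le
    have hTstar : |T k p - Qstar p| ≤
        supNorm (fun p => Q 0 p - Qstar p) + (1 / 3) * ε * (k + 3) := by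
      have := abs_sub_le (T k p) (bellmanD γ P r (Q k) p) (Qstar p)
      linarith
    have hβ0 : 0 ≤ beta (k + 1) := by unfold beta; positivity
    have hβ1 : 0 ≤ 1 - beta (k + 1) :=
      sub_nonneg.2 (div_le_one_of_le₀ (by linarith) (by positivity))
    have hβ : beta (k + 1) * (k + 3) = k + 1 := by
      unfold beta
      push_cast
      field_simp
      ring
    have hQ : Q (k + 1) p - Qstar p =
        (1 - beta (k + 1)) * (Q 0 p - Qstar p) + beta (k + 1) * (T k p - Qstar p) := by
      rw [h1 (k + 1) (by omega) hk, Nat.add_sub_cancel]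
      ring
    calc |Q (k + 1) p - Qstar p|
        ≤ (1 - beta (k + 1)) * |Q 0 p - Qstar p| + beta (k + 1) * |T k p - Qstar p| := by
          rw [hQ]
          refine (abs_add_le _ _).trans_eq ?_
          rw [abs_mul, abs_mul, abs_of_nonneg hβ0, abs_of_nonneg hβ1]
      _ ≤ (1 - beta (k + 1)) * supNorm (fun p => Q 0 p - Qstar p) + beta (k + 1) *
            (supNorm (fun p => Q 0 p - Qstar p) + (1 / 3) * ε * (k + 3)) :=
          add_le_add
            (mul_le_mul_of_nonneg_left (abs_le_supNorm (fun p => Q 0 p - Qstar p) p) hβ1)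
            (mul_le_mul_of_nonneg_left hTstar hβ0)
      _ = supNorm (fun p => Q 0 p - Qstar p) + (1 / 3) * ε * ((k + 1 : ℕ) : ℝ) := by
          push_cast
          linear_combination (1 / 3) * ε * hβ
end

section
/- (Increment bound from the proof of Theorem B.3, discounted case.) Under hypotheses (i)–(iv) of the discounted inexact anchored iteration, for all 1 ≤ k ≤ n one has ‖Q^k − Q^{k−1}‖_∞ ≤ (4/(k+1))·‖Q^0 − Q^*‖_∞ + ε. -/
open Finset

theorem supNorm_eq_norm {J : Type*} [Fintype J] [Nonempty J] (x : J → ℝ) :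
    supNorm x = ‖x‖ := by
  apply le_antisymm
  · exact sup'_le _ _ fun j _ => norm_le_pi_norm x j
  · exact (pi_norm_le_iff_of_nonempty x).2 fun j =>
      le_sup' (fun j => |x j|) (mem_univ j)

theorem sup'_sub_sup'_le {A : Type*} [Fintype A] [Nonempty A] {f g : A → ℝ} {c : ℝ}
    (h : ∀ a, f a - g a ≤ c) :
    univ.sup' univ_nonempty f - univ.sup' univ_nonempty g ≤ c := by
  rw [sub_le_iff_le_add]
  refine sup'_le _ _ fun a _ => ?_
  have := le_sup' g (mem_univ a)
  linarith [h a]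

theorem norm_bellmanD_sub_le {S A : Type*} [Fintype S] [Fintype A] [Nonempty A]
    {γ : ℝ} (hγ : 0 ≤ γ) {P : S → A → S → ℝ} (hP : IsKernel P) (r : S → A → ℝ)
    (x y : S × A → ℝ) :
    ‖bellmanD γ P r x - bellmanD γ P r y‖ ≤ γ * ‖x - y‖ := by
  refine (pi_norm_le_iff_of_nonneg (by positivity)).2 fun p => ?_
  have hsup (s : S) : |univ.sup' univ_nonempty (fun a => x (s, a)) -
      univ.sup' univ_nonempty (fun a => y (s, a))| ≤ ‖x - y‖ := by
    have hxy (a : A) : |x (s, a) - y (s, a)| ≤ ‖x - y‖ := norm_le_pi_norm (x - y) (s, a)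
    rw [abs_sub_le_iff]
    exact ⟨sup'_sub_sup'_le fun a => (abs_sub_le_iff.1 (hxy a)).1,
      sup'_sub_sup'_le fun a => (abs_sub_le_iff.1 (hxy a)).2⟩
  simp only [Pi.sub_apply, bellmanD, add_sub_add_left_eq_sub, ← mul_sub, ← sum_sub_distrib,
    Real.norm_eq_abs, abs_mul, abs_of_nonneg hγ]
  refine mul_le_mul_of_nonneg_left ?_ hγ
  calc _ ≤ ∑ s, P p.1 p.2 s * ‖x - y‖ := by
        refine (abs_sum_le_sum_abs _ _).trans (sum_le_sum fun s _ => ?_)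
        rw [abs_mul, abs_of_nonneg (hP.1 _ _ _)]
        exact mul_le_mul_of_nonneg_left (hsup s) (hP.1 _ _ _)
    _ = ‖x - y‖ := by rw [← sum_mul, hP.2, one_mul]

section AnchoredIteration

variable {E : Type*} [NormedAddCommGroup E] [NormedSpace ℝ E] {q : E} {Q T : ℕ → E}
  {ε : ℝ} {n : ℕ}

/-- The inexact anchored iterates drift from `q` at most linearly in the error `ε`. -/
theorem norm_anchored_sub_le
    (hQ : ∀ k < n, Q (k + 1) = (1 - beta (k + 1)) • Q 0 + beta (k + 1) • T k)
    (hT : ∀ k ≤ n, ‖T k - q‖ ≤ ‖Q k - q‖ + ε) :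
    ∀ k ≤ n, ‖Q k - q‖ ≤ ‖Q 0 - q‖ + k / 3 * ε := by
  intro k
  induction k with
  | zero => simp
  | succ k ih =>
    intro hk
    have hb : beta (k + 1) = ((k : ℝ) + 1) / (k + 3) := by
      unfold beta; push_cast; ring
    have hb0 : 0 ≤ beta (k + 1) := by rw [hb]; positivity
    have hb1 : 0 ≤ 1 - beta (k + 1) := by
      rw [hb, sub_nonneg, div_le_one (by positivity)]; linarith
    have hsplit : Q (k + 1) - q =
        (1 - beta (k + 1)) • (Q 0 - q) + beta (k + 1) • (T k - q) := by
      rw [hQ k (by lia)]; module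
    have hTk : ‖T k - q‖ ≤ ‖Q 0 - q‖ + k / 3 * ε + ε :=
      (hT k (by lia)).trans (by linarith [ih (by lia)])
    calc ‖Q (k + 1) - q‖
        ≤ (1 - beta (k + 1)) * ‖Q 0 - q‖ + beta (k + 1) * ‖T k - q‖ := by
          rw [hsplit]
          refine (norm_add_le _ _).trans_eq ?_
          rw [norm_smul_of_nonneg hb1, norm_smul_of_nonneg hb0]
      _ ≤ (1 - beta (k + 1)) * ‖Q 0 - q‖ +
          beta (k + 1) * (‖Q 0 - q‖ + k / 3 * ε + ε) := by gcongr
      _ = ‖Q 0 - q‖ + ((k + 1 : ℕ) : ℝ) / 3 * ε := by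
          rw [hb]; push_cast; field_simp; ring

theorem norm_anchored_succ_sub_le (hε : 0 ≤ ε)
    (hQ : ∀ k < n, Q (k + 1) = (1 - beta (k + 1)) • Q 0 + beta (k + 1) • T k)
    (hT : ∀ k ≤ n, ‖T k - q‖ ≤ ‖Q k - q‖ + ε)
    (hTT : ∀ k < n, ‖T (k + 1) - T k‖ ≤ ‖Q (k + 1) - Q k‖) :
    ∀ k < n, ‖Q (k + 1) - Q k‖ ≤ 4 / ((k : ℝ) + 2) * ‖Q 0 - q‖ + ε := by
  have hT0 : ∀ k ≤ n, ‖T k - Q 0‖ ≤ 2 * ‖Q 0 - q‖ + (k + 3) / 3 * ε := by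
    intro k hk
    have := norm_sub_le_norm_sub_add_norm_sub (T k) q (Q 0)
    rw [norm_sub_rev q] at this
    linarith [hT k hk, norm_anchored_sub_le hQ hT k hk]
  intro k
  induction k with
  | zero =>
    intro hk
    have hsplit : Q 1 - Q 0 = (1 / 3 : ℝ) • (T 0 - Q 0) := by
      rw [hQ 0 hk, show beta (0 + 1) = 1 / 3 by norm_num [beta]]; module
    have h := hT0 0 (by lia)
    rw [zero_add, hsplit, norm_smul_of_nonneg (by norm_num)]
    push_cast at h ⊢
    linarith [norm_nonneg (Q 0 - q)]
  | succ k ih =>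
    intro hk
    have hsplit : Q (k + 1 + 1) - Q (k + 1) =
        (((k : ℝ) + 2) / (k + 4)) • (T (k + 1) - T k) +
          (2 / (((k : ℝ) + 3) * (k + 4))) • (T k - Q 0) := by
      have hb : beta (k + 1 + 1) = ((k : ℝ) + 2) / (k + 4) := by
        unfold beta; push_cast; ring
      have hb' : beta (k + 1) =
          ((k : ℝ) + 2) / (k + 4) - 2 / (((k : ℝ) + 3) * (k + 4)) := by
        unfold beta; push_cast; field_simp; ring
      rw [hQ (k + 1) hk, hQ k (by lia), hb, hb']; module
    calc ‖Q (k + 1 + 1) - Q (k + 1)‖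
        ≤ ((k : ℝ) + 2) / (k + 4) * ‖T (k + 1) - T k‖ +
          2 / (((k : ℝ) + 3) * (k + 4)) * ‖T k - Q 0‖ := by
          rw [hsplit]
          refine (norm_add_le _ _).trans_eq ?_
          rw [norm_smul_of_nonneg (by positivity), norm_smul_of_nonneg (by positivity)]
      _ ≤ ((k : ℝ) + 2) / (k + 4) * (4 / ((k : ℝ) + 2) * ‖Q 0 - q‖ + ε) +
          2 / (((k : ℝ) + 3) * (k + 4)) * (2 * ‖Q 0 - q‖ + (k + 3) / 3 * ε) := by
          gcongr
          · exact (hTT k (by lia)).trans (ih (by lia))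
          · exact hT0 k (by lia)
      _ = 4 / ((k : ℝ) + 3) * ‖Q 0 - q‖ + ((k : ℝ) + 8 / 3) / (k + 4) * ε := by
          field_simp; ring
      _ ≤ 4 / ((k : ℝ) + 3) * ‖Q 0 - q‖ + 1 * ε := by
          gcongr
          rw [div_le_one (by positivity)]; linarith
      _ = 4 / (((k + 1 : ℕ) : ℝ) + 2) * ‖Q 0 - q‖ + ε := by
          push_cast; ring

end AnchoredIteration

/-- Increment bound from the proof of Theorem B.3 (discounted case): under hypotheses
(i)–(iv), `‖Q^k − Q^{k−1}‖_∞ ≤ (4/(k+1))·‖Q^0 − Q^*‖_∞ + ε` for all `1 ≤ k ≤ n`. -/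
theorem savid_increment_bound

    {S A : Type*} [Fintype S] [Nonempty S] [Fintype A] [Nonempty A]
    (γ : ℝ) (hγ0 : 0 < γ) (hγ1 : γ < 1)
    (P : S → A → S → ℝ) (hP : IsKernel P) (r : S → A → ℝ)
    (ε : ℝ) (hε : 0 ≤ ε) (n : ℕ)
    (Q T : ℕ → S × A → ℝ) (Qstar : S × A → ℝ)
    (h1 : ∀ k, 1 ≤ k → k ≤ n →
      Q k = fun p => (1 - beta k) * Q 0 p + beta k * T (k - 1) p)
    (h2 : ∀ k, k ≤ n → supNorm (fun p => T k p - bellmanD γ P r (Q k) p) ≤ ε)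
    (h3 : Qstar = bellmanD γ P r Qstar)
    (h4 : ∀ k, 1 ≤ k → k ≤ n →
      supNorm (fun p => T k p - T (k - 1) p) ≤ γ * supNorm (fun p => Q k p - Q (k - 1) p))
    :
    ∀ k, 1 ≤ k → k ≤ n → supNorm (fun p => Q k p - Q (k - 1) p)
      ≤ (4 / ((k : ℝ) + 1)) * supNorm (fun p => Q 0 p - Qstar p) + ε := by
  simp only [supNorm_eq_norm] at h2 h4 ⊢
  have hγ (x : S × A → ℝ) : γ * ‖x‖ ≤ ‖x‖ :=
    mul_le_of_le_one_left (norm_nonneg x) hγ1.le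
  have hT : ∀ k ≤ n, ‖T k - Qstar‖ ≤ ‖Q k - Qstar‖ + ε := by
    intro k hk
    have hB := norm_bellmanD_sub_le hγ0.le hP r (Q k) Qstar
    rw [← h3] at hB
    have hTB : ‖T k - bellmanD γ P r (Q k)‖ ≤ ε := h2 k hk
    linarith [norm_sub_le_norm_sub_add_norm_sub (T k) (bellmanD γ P r (Q k)) Qstar,
      hγ (Q k - Qstar)]
  intro k hk hkn
  obtain ⟨k, rfl⟩ := Nat.exists_eq_add_of_le' hk
  have key := norm_anchored_succ_sub_le hε (fun k hk => h1 (k + 1) (by lia) hk) hT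
    (fun k hk => (h4 (k + 1) (by lia) hk).trans (hγ _)) k hkn
  rw [show ((k + 1 : ℕ) : ℝ) + 1 = k + 2 by push_cast; ring]
  exact key
end
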